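/- arXiv:1107.2745 — 2 statements merged into one kernel-verified Lean document; each statement's English description precedes it below -/
import Mathlib

section
/- Let R be a discrete valuation ring that is complete with respect to its maximal ideal m, and assume the residue field R/m is algebraically closed. Let q ≥ 2 be an integer and let φ be a ring automorphism of R such that φ(x) − x^q ∈ m for every x ∈ R, and assume there exists a uniformizer π of R (i.e. a generator of m) with φ(π) = π. Then for every unit c of R there exists a unit x of R with φ(x) = x·c; in other words, the map x ↦ φ(x)·x⁻¹ is surjective on the unit group Rˣ. -/
/-- Neukirch's lemma (abstract form): in a complete DVR with algebraically closed
residue field, if `φ` is a ring automorphism lifting `x ↦ x^q` on the residue field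
and fixing a uniformizer, then `x ↦ φ(x) * x⁻¹` is surjective on units. -/
theorem stmt_0 (R : Type*) [CommRing R] [IsDomain R] [IsDiscreteValuationRing R]
    [IsAdicComplete (IsLocalRing.maximalIdeal R) R]
    [IsAlgClosed (IsLocalRing.ResidueField R)]
    (q : ℕ) (hq : 2 ≤ q) (φ : R ≃+* R)
    (hφ : ∀ x : R, φ x - x ^ q ∈ IsLocalRing.maximalIdeal R)
    (π : R) (hπ : Ideal.span {π} = IsLocalRing.maximalIdeal R) (hφπ : φ π = π) :
    ∀ c : Rˣ, ∃ x : Rˣ, φ (x : R) = (x : R) * (c : R) := by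
  intro c
  have hmem : ∀ (n : ℕ) (a : R), a ∈ IsLocalRing.maximalIdeal R ^ n ↔ π ^ n ∣ a := by
    intro n a
    rw [← hπ, Ideal.span_singleton_pow, Ideal.mem_span_singleton]
  have hmem1 : ∀ a : R, a ∈ IsLocalRing.maximalIdeal R ↔ π ∣ a := by
    intro a
    rw [← hπ, Ideal.mem_span_singleton]
  have hres : ∀ a : R, IsLocalRing.residue R a = 0 ↔ π ∣ a := by
    intro a
    rw [IsLocalRing.residue_eq_zero_iff, hmem1]
  have hφr : ∀ a : R, IsLocalRing.residue R (φ a) = IsLocalRing.residue R a ^ q := by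
    intro a
    have h := (hres _).2 ((hmem1 _).1 (hφ a))
    rwa [map_sub, map_pow, sub_eq_zero] at h
  -- initial approximation
  obtain ⟨x₀, hx₀u, hx₀⟩ : ∃ x₀ : R, IsUnit x₀ ∧ π ∣ φ x₀ - x₀ * c := by
    obtain ⟨z, hz⟩ := IsAlgClosed.exists_pow_nat_eq (IsLocalRing.residue R (c : R))
      (show 0 < q - 1 by omega)
    obtain ⟨x, rfl⟩ := IsLocalRing.residue_surjective z
    refine ⟨x, ?_, ?_⟩
    · rw [← IsLocalRing.residue_ne_zero_iff_isUnit]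
      intro h
      rw [h, zero_pow (by omega)] at hz
      exact (IsLocalRing.residue_ne_zero_iff_isUnit _).2 c.isUnit hz.symm
    · rw [← hres, map_sub, map_mul, hφr, ← hz, ← pow_succ',
        show q - 1 + 1 = q by omega, sub_self]
  -- improvement step
  have step : ∀ (n : ℕ) (x : R), ∃ x' : R, π ^ n ∣ φ x - x * c →
      π ^ n ∣ x' - x ∧ π ^ (n + 1) ∣ φ x' - x' * c := by
    intro n x
    by_cases h : π ^ n ∣ φ x - x * c
    · obtain ⟨b, hb⟩ := h
      obtain ⟨z, hz⟩ : ∃ z : IsLocalRing.ResidueField R,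
          z ^ q - IsLocalRing.residue R c * z + IsLocalRing.residue R b = 0 := by
        let p : Polynomial (IsLocalRing.ResidueField R) :=
          Polynomial.X ^ q + (Polynomial.C (-IsLocalRing.residue R (c : R)) * Polynomial.X
            + Polynomial.C (IsLocalRing.residue R b))
        have hd : p.degree = q := by
          have hlt : (Polynomial.C (-IsLocalRing.residue R (c : R)) * Polynomial.X
              + Polynomial.C (IsLocalRing.residue R b)).degree <
              (Polynomial.X ^ q : Polynomial (IsLocalRing.ResidueField R)).degree := by
            rw [Polynomial.degree_X_pow]
            exact lt_of_le_of_lt Polynomial.degree_linear_le (by exact_mod_cast hq)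
          rw [show p = _ from rfl, Polynomial.degree_add_eq_left_of_degree_lt hlt,
            Polynomial.degree_X_pow]
        obtain ⟨z, hz⟩ := IsAlgClosed.exists_root p (by
          rw [hd]
          exact_mod_cast (by omega : q ≠ 0))
        refine ⟨z, ?_⟩
        simp only [p, Polynomial.IsRoot, Polynomial.eval_add, Polynomial.eval_mul,
          Polynomial.eval_pow, Polynomial.eval_X, Polynomial.eval_C] at hz
        linear_combination hz
      obtain ⟨y, rfl⟩ := IsLocalRing.residue_surjective z
      have hy : π ∣ φ y - c * y + b := by
        rw [← hres, map_add, map_sub, map_mul, hφr, hz]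
      obtain ⟨w, hw⟩ := hy
      refine ⟨x + π ^ n * y, fun _ => ⟨⟨y, by ring⟩, ⟨w, ?_⟩⟩⟩
      rw [map_add, map_mul, map_pow, hφπ]
      linear_combination hb + π ^ n * hw
    · exact ⟨0, fun h' => absurd h' h⟩
  choose f hf using step
  let s : ℕ → R := fun n => Nat.rec x₀ (fun n x => f (n + 1) x) n
  have hs : ∀ n, π ^ (n + 1) ∣ φ (s n) - s n * c := by
    intro n
    induction n with
    | zero => simpa [s] using hx₀
    | succ n ih => exact (hf (n + 1) (s n) ih).2
  have hs' : ∀ n, π ^ (n + 1) ∣ s (n + 1) - s n := fun n => (hf (n + 1) (s n) (hs n)).1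
  have hcauchy : ∀ m k, π ^ (m + 1) ∣ s (m + k) - s m := by
    intro m k
    induction k with
    | zero => simp
    | succ k ih =>
      have h1 := (pow_dvd_pow π (by omega : m + 1 ≤ m + k + 1)).trans (hs' (m + k))
      have h2 := dvd_add h1 ih
      rwa [sub_add_sub_cancel] at h2
  obtain ⟨L, hL⟩ := IsPrecomplete.prec (I := IsLocalRing.maximalIdeal R) (M := R) inferInstance
    (f := s) (by
      intro m n hmn
      obtain ⟨k, rfl⟩ := Nat.exists_eq_add_of_le hmn
      rw [SModEq.comm, SModEq.sub_mem, smul_eq_mul, Ideal.mul_top, hmem]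
      exact (pow_dvd_pow π (Nat.le_succ m)).trans (hcauchy m k))
  have hL' : ∀ n, π ^ n ∣ L - s n := by
    intro n
    have h := (hL n).symm
    rwa [SModEq.sub_mem, smul_eq_mul, Ideal.mul_top, hmem] at h
  have hLu : IsUnit L := by
    rw [← IsLocalRing.residue_ne_zero_iff_isUnit] at hx₀u ⊢
    have h1 : π ∣ L - s 1 := by simpa using hL' 1
    have h2 : π ∣ s 1 - s 0 := by simpa using hs' 0
    have h3 := dvd_add h1 h2
    rw [sub_add_sub_cancel, ← hres, map_sub, sub_eq_zero] at h3
    rw [h3]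
    exact hx₀u
  refine ⟨hLu.unit, ?_⟩
  rw [IsUnit.unit_spec, ← sub_eq_zero]
  apply IsHausdorff.haus (I := IsLocalRing.maximalIdeal R) (M := R) inferInstance
  intro n
  rw [SModEq.sub_mem, smul_eq_mul, Ideal.mul_top, hmem, sub_zero]
  obtain ⟨w, hw⟩ := hL' n
  obtain ⟨v, hv⟩ := hs n
  have e : φ L - φ (s n) = π ^ n * φ w := by
    rw [← map_sub, hw, map_mul, map_pow, hφπ]
  exact ⟨φ w - w * c + π * v, by linear_combination e - c * hw + hv⟩
end

section
/- Let F and K be number fields contained in a fixed algebraic closure of ℚ, let p be a rational prime, and assume: F/ℚ is a Galois extension, p is totally split in F, and F ∩ K = ℚ. Let FK denote the compositum of F and K. Fix a prime 𝔮 of O_F lying above p and a prime 𝔓 of O_K lying above p. Then there exists exactly one prime 𝔔 of O_{FK} lying above both 𝔓 and 𝔮 (i.e. with 𝔔 ∩ O_K = 𝔓 and 𝔔 ∩ O_F = 𝔮). -/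
open NumberField
open scoped Pointwise

theorem gen (F K E : Type*) [Field F] [Field K] [Field E] [NumberField F] [NumberField K] [NumberField E]
    [Algebra F E] [Algebra K E] [IsGalois ℚ F] [IsGalois K E]
    (r : Gal(E/K) →* Gal(F/ℚ)) (hrb : Function.Bijective r)
    (hr : ∀ σ x, algebraMap F E (r σ x) = σ (algebraMap F E x))
    (p : ℕ) (hp : p.Prime)
    (hsplit : ∀ Q : Ideal (𝓞 F), Q.IsPrime → Q ≠ ⊥ → (p : 𝓞 F) ∈ Q →
      Ideal.ramificationIdx' (Ideal.span {(p : ℤ)}) Q = 1 ∧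
      Ideal.inertiaDeg' (Ideal.span {(p : ℤ)}) Q = 1)
    (𝔮 : Ideal (𝓞 F)) (h𝔮 : 𝔮.IsPrime) (h𝔮0 : 𝔮 ≠ ⊥) (h𝔮p : (p : 𝓞 F) ∈ 𝔮)
    (𝔓 : Ideal (𝓞 K)) (h𝔓 : 𝔓.IsPrime) (h𝔓p : (p : 𝓞 K) ∈ 𝔓) :
    ∃! 𝔔 : Ideal (𝓞 E), 𝔔.IsPrime ∧ Ideal.comap (algebraMap (𝓞 K) (𝓞 E)) 𝔔 = 𝔓 ∧
      Ideal.comap (algebraMap (𝓞 F) (𝓞 E)) 𝔔 = 𝔮 := by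
  have key (σ : Gal(E/K)) (I : Ideal (𝓞 E)) :
      Ideal.comap (algebraMap (𝓞 F) (𝓞 E)) (σ • I) =
        r σ • Ideal.comap (algebraMap (𝓞 F) (𝓞 E)) I := by
    ext x
    rw [Ideal.mem_comap, Ideal.mem_pointwise_smul_iff_inv_smul_mem,
      Ideal.mem_pointwise_smul_iff_inv_smul_mem, Ideal.mem_comap, ← map_inv]
    have : σ⁻¹ • algebraMap (𝓞 F) (𝓞 E) x = algebraMap (𝓞 F) (𝓞 E) (r σ⁻¹ • x) := by
      apply RingOfIntegers.ext
      exact (hr σ⁻¹ x).symm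
    rw [this]
  have hpp : (Ideal.span {(p : ℤ)}).IsPrime :=
    (Ideal.span_singleton_prime (by exact_mod_cast hp.ne_zero)).2 (Nat.prime_iff_prime_int.1 hp)
  have hpm : (Ideal.span {(p : ℤ)}).IsMaximal :=
    hpp.isMaximal (by simpa using hp.ne_zero)
  have hover (Q : Ideal (𝓞 F)) (hQ : Q.IsPrime) (hQp : (p : 𝓞 F) ∈ Q) :
      Q.LiesOver (Ideal.span {(p : ℤ)}) := by
    refine ⟨hpm.eq_of_le (Ideal.IsPrime.under ℤ Q).ne_top ?_⟩
    rw [Ideal.span_singleton_le_iff_mem, Ideal.under, Ideal.mem_comap]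
    simpa using hQp
  have hstab : ∀ g : Gal(F/ℚ), g • 𝔮 = 𝔮 → g = 1 := by
    have := hover 𝔮 h𝔮 h𝔮p
    have hc := Ideal.card_stabilizer_eq (G := Gal(F/ℚ)) (Ideal.span {(p : ℤ)}) 𝔮
    obtain ⟨h1, h2⟩ := hsplit 𝔮 h𝔮 h𝔮0 h𝔮p
    rw [Ideal.ramificationIdxIn_eq_ramificationIdx _ 𝔮 Gal(F/ℚ),
      Ideal.inertiaDegIn_eq_inertiaDeg _ 𝔮 Gal(F/ℚ)] at hc
    have hqm : 𝔮.IsMaximal := h𝔮.isMaximal h𝔮0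
    have e1 : 𝔮.ramificationIdx ℤ = 1 := by
      rw [← Ideal.ramificationIdx'_eq_ramificationIdx (Ideal.span {(p : ℤ)}) 𝔮
        (by simpa using hp.ne_zero), h1]
    have e2 : 𝔮.inertiaDeg ℤ = 1 := by
      rw [← Ideal.inertiaDeg'_eq_inertiaDeg (Ideal.span {(p : ℤ)}) 𝔮, h2]
    rw [e1, e2, mul_one, Subgroup.card_eq_one] at hc
    intro g hg
    have : g ∈ MulAction.stabilizer Gal(F/ℚ) 𝔮 := hg
    rwa [hc, Subgroup.mem_bot] at this
  have hover' (Q : Ideal (𝓞 E)) (h : Ideal.comap (algebraMap (𝓞 K) (𝓞 E)) Q = 𝔓) : Q.LiesOver 𝔓 :=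
    ⟨h.symm⟩
  refine existsUnique_of_exists_of_unique ?_ ?_
  · obtain ⟨⟨Q, hQ, hQ'⟩⟩ := (inferInstance : Nonempty (𝔓.primesOver (𝓞 E)))
    have hQp : (p : 𝓞 F) ∈ Ideal.comap (algebraMap (𝓞 F) (𝓞 E)) Q := by
      have h : (p : 𝓞 K) ∈ Ideal.comap (algebraMap (𝓞 K) (𝓞 E)) Q := by
        rw [hQ'.over] at h𝔓p
        exact h𝔓p
      rw [Ideal.mem_comap, map_natCast] at h ⊢
      exact h
    have hpr : (Ideal.comap (algebraMap (𝓞 F) (𝓞 E)) Q).IsPrime := Ideal.comap_isPrime _ _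
    have := hover _ hpr hQp
    have := hover 𝔮 h𝔮 h𝔮p
    obtain ⟨g, hg⟩ := Ideal.exists_smul_eq_of_isGaloisGroup (Ideal.span {(p : ℤ)})
      (Ideal.comap (algebraMap (𝓞 F) (𝓞 E)) Q) 𝔮 Gal(F/ℚ)
    obtain ⟨σ, rfl⟩ := hrb.2 g
    refine ⟨σ • Q, inferInstance, ?_, ?_⟩
    · have : (σ • Q).LiesOver 𝔓 := inferInstance
      exact this.over.symm
    · rw [key, hg]
  · rintro Q Q' ⟨hQ, hK, hF⟩ ⟨hQ', hK', hF'⟩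
    have := hover' Q hK
    have := hover' Q' hK'
    obtain ⟨σ, rfl⟩ := Ideal.exists_smul_eq_of_isGaloisGroup 𝔓 Q Q' Gal(E/K)
    rw [key, hF] at hF'
    have := hrb.1 ((hstab _ hF').trans (map_one r).symm)
    rw [this, one_smul]

theorem fieldpart (k Ω : Type*) [Field k] [CharZero k] [Field Ω] [Algebra k Ω] (F K : IntermediateField k Ω)
    [algF : Algebra F ↥(F ⊔ K)] (hF : algF =
      (IntermediateField.inclusion (le_sup_left : F ≤ F ⊔ K)).toRingHom.toAlgebra)
    [algK : Algebra K ↥(F ⊔ K)] (hK : algK =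
      (IntermediateField.inclusion (le_sup_right : K ≤ F ⊔ K)).toRingHom.toAlgebra)
    [i : Algebra k ↥F] (hi : i = IntermediateField.algebra' F)
    [FiniteDimensional k ↥F] [FiniteDimensional k ↥K] [IsGalois k ↥F] (hFK : F ⊓ K = ⊥) :
    IsGalois K ↥(F ⊔ K) ∧ ∃ r : Gal(↥(F ⊔ K)/K) →* Gal(F/k), Function.Bijective r ∧
      ∀ σ x, algebraMap F ↥(F ⊔ K) (r σ x) = σ (algebraMap F ↥(F ⊔ K) x) := by
  subst hi hF hK
  let algF : Algebra F ↥(F ⊔ K) :=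
    (IntermediateField.inclusion (le_sup_left : F ≤ F ⊔ K)).toRingHom.toAlgebra
  let algK : Algebra K ↥(F ⊔ K) :=
    (IntermediateField.inclusion (le_sup_right : K ≤ F ⊔ K)).toRingHom.toAlgebra
  have : IsScalarTower k F ↥(F ⊔ K) := .of_algebraMap_eq fun _ => rfl
  have : IsScalarTower k K ↥(F ⊔ K) := .of_algebraMap_eq fun _ => rfl
  have : FiniteDimensional K ↥(F ⊔ K) := FiniteDimensional.right k _ _
  let A' : IntermediateField k ↥(F ⊔ K) := F.restrict le_sup_left
  let B' : IntermediateField k ↥(F ⊔ K) := K.restrict le_sup_right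
  have h₁ : A' ⊔ B' = ⊤ := by
    rw [← IntermediateField.lift_inj, IntermediateField.lift_top, IntermediateField.lift_sup,
      IntermediateField.lift_restrict le_sup_left, IntermediateField.lift_restrict le_sup_right]
  have : IsGalois k A' := IsGalois.of_algEquiv <| IntermediateField.restrictAlgEquiv ..
  have : FiniteDimensional k A' := inferInstance
  have hB' : IsGalois B' ↥(F ⊔ K) := IsGalois.sup_right A' B' h₁
  have : IsGalois K ↥(F ⊔ K) := by
    refine IsGalois.of_equiv_equiv (F := B') (E := ↥(F ⊔ K))
      (f := (IntermediateField.restrictAlgEquiv (le_sup_right : K ≤ F ⊔ K)).symm.toRingEquiv)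
      (g := RingEquiv.refl _) ?_
    ext x
    obtain ⟨y, rfl⟩ := (IntermediateField.restrictAlgEquiv (le_sup_right : K ≤ F ⊔ K)).surjective x
    simp
    rfl
  let r := IntermediateField.restrictRestrictAlgEquivMapHom k F K ↥(F ⊔ K)
  have hr : ∀ σ x, algebraMap F ↥(F ⊔ K) (r σ x) = σ (algebraMap F ↥(F ⊔ K) x) := by
    intro σ x
    exact AlgEquiv.restrictNormal_commutes (MulSemiringAction.toAlgAut Gal(↥(F ⊔ K)/K) k ↥(F ⊔ K) σ) F x
  have hinj : Function.Injective r := by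
    refine (injective_iff_map_eq_one _).mpr fun φ hφ ↦ ?_
    suffices h : MulSemiringAction.toAlgAut Gal(↥(F ⊔ K)/K) k ↥(F ⊔ K) φ = 1 by
      rwa [AlgEquiv.ext_iff] at h ⊢
    rw [← Subgroup.mem_bot, ← IntermediateField.fixingSubgroup_top, ← h₁, IntermediateField.fixingSubgroup_sup]
    refine ⟨?_, ?_⟩
    · rintro ⟨x, hx⟩
      have := hr φ ⟨x.1, (IntermediateField.mem_restrict _ x).1 hx⟩
      rw [hφ] at this
      exact this.symm
    · rintro ⟨x, hx⟩
      exact φ.commutes ⟨x.1, (IntermediateField.mem_restrict _ x).1 hx⟩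
  have hcard : Nat.card Gal(↥(F ⊔ K)/K) = Nat.card Gal(F/k) := by
    rw [IsGalois.card_aut_eq_finrank, IsGalois.card_aut_eq_finrank]
    have h1 := (IntermediateField.LinearDisjoint.of_inf_eq_bot hFK).finrank_sup
    have h2 := Module.finrank_mul_finrank k K ↥(F ⊔ K)
    have h3 : 0 < Module.finrank k K := Module.finrank_pos
    rw [← h2, mul_comm] at h1
    exact Nat.eq_of_mul_eq_mul_right h3 h1
  have hbij : Function.Bijective r := (Nat.bijective_iff_injective_and_card r).2 ⟨hinj, hcard⟩
  exact ⟨inferInstance, r, hbij, hr⟩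

theorem stmt_5 (F K : IntermediateField ℚ (AlgebraicClosure ℚ))
    [FiniteDimensional ℚ ↥F] [FiniteDimensional ℚ ↥K]
    [IsGalois ℚ ↥F]
    (p : ℕ) (hp : p.Prime)
    (hsplit : ∀ Q : Ideal (𝓞 ↥F), Q.IsPrime → Q ≠ ⊥ → (p : 𝓞 ↥F) ∈ Q →
      Ideal.ramificationIdx' (Ideal.span {(p : ℤ)}) Q = 1 ∧
      Ideal.inertiaDeg' (Ideal.span {(p : ℤ)}) Q = 1)
    (hFK : F ⊓ K = ⊥)
    (ιK : 𝓞 ↥K →+* 𝓞 ↥(F ⊔ K))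
    (hιK : ∀ x : 𝓞 ↥K, algebraMap (𝓞 ↥(F ⊔ K)) ↥(F ⊔ K) (ιK x) =
      IntermediateField.inclusion (le_sup_right : K ≤ F ⊔ K) (algebraMap (𝓞 ↥K) ↥K x))
    (ιF : 𝓞 ↥F →+* 𝓞 ↥(F ⊔ K))
    (hιF : ∀ x : 𝓞 ↥F, algebraMap (𝓞 ↥(F ⊔ K)) ↥(F ⊔ K) (ιF x) =
      IntermediateField.inclusion (le_sup_left : F ≤ F ⊔ K) (algebraMap (𝓞 ↥F) ↥F x))
    (𝔮 : Ideal (𝓞 ↥F)) (h𝔮 : 𝔮.IsPrime) (h𝔮0 : 𝔮 ≠ ⊥) (h𝔮p : (p : 𝓞 ↥F) ∈ 𝔮)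
    (𝔓 : Ideal (𝓞 ↥K)) (h𝔓 : 𝔓.IsPrime) (h𝔓0 : 𝔓 ≠ ⊥) (h𝔓p : (p : 𝓞 ↥K) ∈ 𝔓) :
    ∃! 𝔔 : Ideal (𝓞 ↥(F ⊔ K)), 𝔔.IsPrime ∧ Ideal.comap ιK 𝔔 = 𝔓 ∧ Ideal.comap ιF 𝔔 = 𝔮 := by
  have : NumberField F := {}
  have : NumberField K := {}
  have : NumberField ↥(F ⊔ K) := {}
  let algF : Algebra F ↥(F ⊔ K) :=
    (IntermediateField.inclusion (le_sup_left : F ≤ F ⊔ K)).toRingHom.toAlgebra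
  let algK : Algebra K ↥(F ⊔ K) :=
    (IntermediateField.inclusion (le_sup_right : K ≤ F ⊔ K)).toRingHom.toAlgebra
  have eK : ιK = algebraMap (𝓞 K) (𝓞 ↥(F ⊔ K)) := by
    ext1 x
    apply RingOfIntegers.ext
    exact hιK x
  have eF : ιF = algebraMap (𝓞 F) (𝓞 ↥(F ⊔ K)) := by
    ext1 x
    apply RingOfIntegers.ext
    exact hιF x
  have hd : (DivisionRing.toRatAlgebra : Algebra ℚ F) = IntermediateField.algebra' F :=
    Subsingleton.elim _ _
  obtain ⟨hG, r, hbij, hr⟩ := fieldpart ℚ (AlgebraicClosure ℚ) F K rfl rfl hd hFK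
  rw [eK, eF]
  exact gen F K ↥(F ⊔ K) r hbij hr p hp hsplit 𝔮 h𝔮 h𝔮0 h𝔮p 𝔓 h𝔓 h𝔓p
end
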